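/- arXiv:2211.08763 — 2 statements merged into one kernel-verified Lean document; each statement's English description precedes it below -/
import Mathlib

section
/- Let n > 0 be real. Then ∫_0^∞ Γ((−1+it)/4)·Γ((−1−it)/4)·Ξ(t/2)²·cos(nt)/(1+t²) dt = π^{3/2} ∫_0^∞ (1/(e^{x e^n} − 1) − 1/(x e^n))·(1/(e^{x e^{−n}} − 1) − 1/(x e^{−n})) dx. -/
noncomputable section
open Complex MeasureTheory Set Filter Topology


/-- The Riemann xi function. -/
def RiemannXi (s : ℂ) : ℂ :=
  (1/2) * s * (s - 1) * (Real.pi : ℂ) ^ (-s / 2) * Complex.Gamma (s / 2) * riemannZeta s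

/-- The Riemann Xi function `Ξ(t) = ξ(1/2 + it)`. -/
def RiemannBigXi (t : ℂ) : ℂ := RiemannXi (1 / 2 + I * t)


def fr (x : ℝ) : ℝ := 1 / (Real.exp x - 1) - 1 / x

def fr' (x : ℝ) : ℝ := -(Real.exp x) / (Real.exp x - 1) ^ 2 + 1 / x ^ 2

lemma E_ge {x : ℝ} (_hx : 0 < x) : x ≤ Real.exp x - 1 := by
  linarith [Real.add_one_le_exp x]

lemma E_ge2 {x : ℝ} (hx : 0 < x) : x ^ 2 / 2 ≤ Real.exp x - 1 := by
  linarith [Real.quadratic_le_exp_of_nonneg hx.le]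

lemma fr_nonpos {x : ℝ} (hx : 0 < x) : fr x ≤ 0 := by
  have := one_div_le_one_div_of_le hx (E_ge hx)
  unfold fr; linarith

lemma fr_abs_le_inv {x : ℝ} (hx : 0 < x) : |fr x| ≤ 1 / x := by
  rw [abs_of_nonpos (fr_nonpos hx)]
  have : 0 ≤ 1 / (Real.exp x - 1) := by
    have := E_ge hx
    exact one_div_nonneg.2 (by linarith)
  unfold fr; linarith

lemma fr_abs_le_one {x : ℝ} (hx : 0 < x) : |fr x| ≤ 1 := by
  rw [abs_of_nonpos (fr_nonpos hx)]
  have hE := E_ge hx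
  have hE0 : 0 < Real.exp x - 1 := by linarith
  have h1 : Real.exp x - 1 ≤ x * Real.exp x := by
    have h := Real.add_one_le_exp (-x)
    have h2 : Real.exp (-x) * Real.exp x = 1 := by rw [← Real.exp_add]; simp
    nlinarith [Real.exp_pos x]
  have : -fr x = (Real.exp x - 1 - x) / (x * (Real.exp x - 1)) := by
    unfold fr; field_simp; ring
  rw [this, div_le_one (by positivity)]
  linarith

lemma fr_hasDeriv {x : ℝ} (hx : 0 < x) : HasDerivAt fr (fr' x) x := by
  have hE0 : Real.exp x - 1 ≠ 0 := by linarith [E_ge hx]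
  have h1 : HasDerivAt (fun x => (Real.exp x - 1)⁻¹) _ x :=
    ((Real.hasDerivAt_exp x).sub_const 1).inv hE0
  have h2 := (hasDerivAt_inv hx.ne')
  have := h1.sub h2
  have e1 : fr = (fun x => (Real.exp x - 1)⁻¹) - fun y => y⁻¹ := by
    ext y; simp [fr]
  have e2 : fr' x = -Real.exp x / (Real.exp x - 1) ^ 2 - -(x ^ 2)⁻¹ := by
    simp [fr']
  rw [e1, e2]
  exact this

lemma fr'_eq {x : ℝ} (hx : 0 < x) :
    fr' x = -fr x * (1 / x + 1 / (Real.exp x - 1)) - 1 / (Real.exp x - 1) := by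
  have hE0 : Real.exp x - 1 ≠ 0 := by linarith [E_ge hx]
  unfold fr' fr
  field_simp
  ring

lemma fr'_abs_le {x : ℝ} (hx : 0 < x) :
    |fr' x| ≤ |fr x| * (2 / x) + 1 / (Real.exp x - 1) := by
  have hE := one_div_le_one_div_of_le hx (E_ge hx)
  have hE1 : 0 ≤ 1 / (Real.exp x - 1) := one_div_nonneg.2 (by linarith [E_ge hx])
  have hx1 : 0 ≤ 1 / x := by positivity
  rw [fr'_eq hx]
  refine (abs_sub _ _).trans ?_
  rw [abs_mul, abs_neg, abs_of_nonneg hE1, abs_of_nonneg (by linarith : 0 ≤ 1 / x + 1 / (Real.exp x - 1))]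
  have : 2 / x = 1 / x + 1 / x := by ring
  rw [this]
  gcongr

lemma fr'_abs_le1 {x : ℝ} (hx : 0 < x) : |fr' x| ≤ 4 / x := by
  have hE := one_div_le_one_div_of_le hx (E_ge hx)
  have hx1 : 0 ≤ 1 / x := by positivity
  refine (fr'_abs_le hx).trans ?_
  have : |fr x| * (2 / x) ≤ 1 * (2 / x) := by gcongr; exact fr_abs_le_one hx
  have h4 : 4 / x = 4 * (1 / x) := by ring
  have h2 : 2 / x = 2 * (1 / x) := by ring
  rw [h4]; linarith

lemma fr'_abs_le2 {x : ℝ} (hx : 0 < x) : |fr' x| ≤ 4 / x ^ 2 := by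
  have hE := one_div_le_one_div_of_le (by positivity) (E_ge2 hx)
  refine (fr'_abs_le hx).trans ?_
  have : |fr x| * (2 / x) ≤ 1 / x * (2 / x) := by gcongr; exact fr_abs_le_inv hx
  have h4 : 4 / x ^ 2 = 1 / x * (2 / x) + 1 / (x ^ 2 / 2) := by field_simp; norm_num
  rw [h4]; linarith

/-- The logarithmic rescaling of `fr`. -/
def GG (u : ℝ) : ℂ := ((Real.exp (-(1/2) * u) * fr (Real.exp (-u)) : ℝ) : ℂ)

def GG' (u : ℝ) : ℝ := (-(1/2) * Real.exp (-(1/2) * u)) * fr (Real.exp (-u)) +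
  Real.exp (-(1/2) * u) * (fr' (Real.exp (-u)) * (-Real.exp (-u)))

lemma GG_hasDeriv (u : ℝ) : HasDerivAt GG (GG' u : ℂ) u := by
  apply HasDerivAt.ofReal_comp
  have h1 : HasDerivAt (fun u : ℝ => Real.exp (-(1/2) * u)) (-(1/2) * Real.exp (-(1/2) * u)) u := by
    have := ((hasDerivAt_id u).const_mul (-(1/2) : ℝ)).exp
    simpa [mul_comm] using this
  have h2 : HasDerivAt (fun u : ℝ => Real.exp (-u)) (-Real.exp (-u)) u := by
    have := (hasDerivAt_neg u).exp
    simpa using this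
  have h3 : HasDerivAt (fun y => fr (Real.exp (-y))) (fr' (Real.exp (-u)) * -Real.exp (-u)) u :=
    HasDerivAt.comp (h₂ := fr) u (fr_hasDeriv (Real.exp_pos (-u))) h2
  exact h1.mul h3

lemma fr_exp_bound (u : ℝ) : Real.exp (-(1/2) * u) * |fr (Real.exp (-u))| ≤ Real.exp (-(1/2) * |u|) := by
  have hp := Real.exp_pos (-u)
  rcases le_total 0 u with h | h
  · rw [abs_of_nonneg h]
    have := fr_abs_le_one hp
    have := Real.exp_pos (-(1/2) * u)
    nlinarith
  · rw [abs_of_nonpos h]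
    have h1 := fr_abs_le_inv hp
    calc _ ≤ Real.exp (-(1/2) * u) * (1 / Real.exp (-u)) := by gcongr
      _ = _ := by rw [one_div (Real.exp (-u)), ← Real.exp_neg, ← Real.exp_add]; ring_nf

lemma fr'_exp_bound (u : ℝ) : Real.exp (-(1/2) * u) * (|fr' (Real.exp (-u))| * Real.exp (-u))
    ≤ 4 * Real.exp (-(1/2) * |u|) := by
  have hp := Real.exp_pos (-u)
  rcases le_total 0 u with h | h
  · rw [abs_of_nonneg h]
    have h1 := fr'_abs_le1 hp
    calc _ ≤ Real.exp (-(1/2) * u) * (4 / Real.exp (-u) * Real.exp (-u)) := by gcongr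
      _ = _ := by field_simp
  · rw [abs_of_nonpos h]
    have h1 := fr'_abs_le2 hp
    calc _ ≤ Real.exp (-(1/2) * u) * (4 / Real.exp (-u) ^ 2 * Real.exp (-u)) := by gcongr
      _ = 4 * (Real.exp (-(1/2) * u) * (1 / Real.exp (-u))) := by field_simp
      _ = _ := by rw [one_div (Real.exp (-u)), ← Real.exp_neg, ← Real.exp_add]; ring_nf

lemma GG_norm (u : ℝ) : ‖GG u‖ ≤ Real.exp (-(1/2) * |u|) := by
  rw [GG, Complex.norm_real, Real.norm_eq_abs, abs_mul, abs_of_pos (Real.exp_pos _)]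
  exact fr_exp_bound u

lemma GG'_norm (u : ℝ) : |GG' u| ≤ 5 * Real.exp (-(1/2) * |u|) := by
  unfold GG'
  refine (abs_add_le _ _).trans ?_
  have h1 := fr_exp_bound u
  have h2 := fr'_exp_bound u
  simp only [abs_mul, abs_neg, abs_of_pos (Real.exp_pos _)] at *
  rw [abs_of_pos (by norm_num : (0:ℝ) < 1/2)]
  have := Real.exp_pos (-(1/2) * |u|)
  linarith

lemma integrable_expabs : Integrable (fun u : ℝ => Real.exp (-(1/2) * |u|)) := by
  have h0 : IntegrableOn (fun u : ℝ => Real.exp (-(1/2) * |u|)) (Ioi 0) := by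
    refine (integrableOn_exp_mul_Ioi (by norm_num : (-(1/2) : ℝ) < 0) 0).congr_fun ?_ measurableSet_Ioi
    intro x hx
    simp only [abs_of_pos (mem_Ioi.1 hx)]
  have h1 : IntegrableOn (fun u : ℝ => Real.exp (-(1/2) * |u|)) (Iic 0) := by
    refine (integrableOn_exp_mul_Iic (by norm_num : (0 : ℝ) < 1/2) 0).congr_fun ?_ measurableSet_Iic
    intro x hx
    simp only [abs_of_nonpos (mem_Iic.1 hx)]
    ring_nf
  rw [← integrableOn_univ, ← Iic_union_Ioi (a := (0:ℝ))]
  exact h1.union h0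

lemma GG_diff : Differentiable ℝ GG := fun u => (GG_hasDeriv u).differentiableAt

lemma GG_cont : Continuous GG := GG_diff.continuous

lemma GG_int : Integrable GG :=
  integrable_expabs.mono' GG_cont.aestronglyMeasurable (ae_of_all _ GG_norm)

lemma GG_deriv_int : Integrable (deriv GG) := by
  refine (integrable_expabs.const_mul 5).mono' (aestronglyMeasurable_deriv _ _) (ae_of_all _ fun u => ?_)
  rw [(GG_hasDeriv u).deriv, Complex.norm_real]
  exact GG'_norm u

/-! ### The Mellin transform of `fr` -/

def kk (x : ℝ) : ℂ := ((1 / (Real.exp x - 1) : ℝ) : ℂ)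

def hh (x : ℝ) : ℂ := kk x - indicator (Ioc 0 1) (fun t : ℝ => (t : ℂ) ^ (-1 : ℂ)) x

lemma kk_meas : Measurable kk := by unfold kk; fun_prop

lemma hh_meas : Measurable hh := by
  unfold hh
  refine kk_meas.sub (Measurable.indicator ?_ measurableSet_Ioc)
  simp_rw [cpow_neg_one]
  fun_prop

lemma kk_top : kk =O[atTop] fun t => Real.exp (-1 * t) := by
  refine Asymptotics.IsBigO.of_bound 2 ?_
  filter_upwards [eventually_ge_atTop (1:ℝ)] with x hx
  have h1 : 2 ≤ Real.exp x := by linarith [Real.add_one_le_exp x]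
  rw [kk, Complex.norm_real, Real.norm_eq_abs, Real.norm_eq_abs, abs_of_pos (Real.exp_pos _),
    abs_of_pos (one_div_pos.2 (by linarith)), neg_one_mul, Real.exp_neg]
  rw [← div_eq_mul_inv, div_le_div_iff₀ (by linarith) (by linarith)]
  linarith

lemma kk_bot : kk =O[𝓝[>] 0] (· ^ (-1 : ℝ)) := by
  refine Asymptotics.IsBigO.of_bound 1 ?_
  filter_upwards [self_mem_nhdsWithin] with x hx
  have hx : 0 < x := hx
  rw [kk, Complex.norm_real, Real.norm_eq_abs, Real.norm_eq_abs, Real.rpow_neg_one,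
    abs_of_pos (inv_pos.2 hx), abs_of_pos (one_div_pos.2 (by linarith [E_ge hx])), one_mul, ← one_div]
  exact one_div_le_one_div_of_le hx (E_ge hx)

lemma kk_loc : LocallyIntegrableOn kk (Ioi 0) := by
  refine ContinuousOn.locallyIntegrableOn ?_ measurableSet_Ioi
  unfold kk
  refine Complex.continuous_ofReal.comp_continuousOn ?_
  refine ContinuousOn.div (by fun_prop) (by fun_prop) ?_
  intro x hx
  have := E_ge (mem_Ioi.1 hx)
  have := mem_Ioi.1 hx
  linarith

lemma kk_conv {s : ℂ} (hs : 1 < s.re) : MellinConvergent kk s :=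
  mellinConvergent_of_isBigO_rpow_exp one_pos kk_loc kk_top kk_bot hs

lemma kk_mellin {s : ℂ} (hs : 1 < s.re) : mellin kk s = Complex.Gamma s * riemannZeta s := by
  have key := hasSum_mellin (ι := ℕ) (a := fun _ => 1) (p := fun i => (i : ℝ) + 1) (F := kk) (s := s)
    (fun i => Or.inr (by positivity)) (by linarith) ?_ ?_
  · rw [← key.tsum_eq, zeta_eq_tsum_one_div_nat_add_one_cpow hs, ← tsum_mul_left]
    congr 1; ext i; push_cast; ring
  · intro t ht
    have ht : 0 < t := ht
    have h1 : Real.exp (-t) < 1 := by simpa using ht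
    have := (hasSum_geometric_of_lt_one (Real.exp_pos (-t)).le h1).mul_left (Real.exp (-t))
    have h2 : HasSum (fun i : ℕ => Real.exp (-((i:ℝ) + 1) * t)) (1 / (Real.exp t - 1)) := by
      have e1 : (fun i : ℕ => Real.exp (-((i:ℝ) + 1) * t)) =
          fun i : ℕ => Real.exp (-t) * Real.exp (-t) ^ i := by
        ext i
        rw [← Real.exp_nat_mul, ← Real.exp_add]; ring_nf
      have e2 : 1 / (Real.exp t - 1) = Real.exp (-t) * (1 - Real.exp (-t))⁻¹ := by
        have := E_ge ht
        have h3 : Real.exp t - 1 ≠ 0 := by linarith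
        have h4 : 1 - (Real.exp t)⁻¹ ≠ 0 := by rw [Real.exp_neg] at h1; linarith
        rw [Real.exp_neg]
        field_simp
      rw [e1, e2]
      exact this
    have h3 := Complex.hasSum_ofReal.2 h2
    simpa [kk] using h3
  · have := (summable_nat_add_iff 1).2 (Real.summable_one_div_nat_rpow.2 hs)
    simpa using this

lemma hh_eq_fr {x : ℝ} (hx : x ∈ Ioc (0:ℝ) 1) : hh x = (fr x : ℂ) := by
  rw [hh, indicator_of_mem hx, cpow_neg_one, kk, fr]; push_cast; ring

lemma hh_eq_kk {x : ℝ} (hx : 1 < x) : hh x = kk x := by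
  rw [hh, indicator_of_notMem (by simp [hx]), sub_zero]

lemma hh_bound {x : ℝ} (hx : 0 < x) : ‖hh x‖ ≤ 1 := by
  rcases le_or_gt x 1 with h | h
  · rw [hh_eq_fr ⟨hx, h⟩, Complex.norm_real]; exact fr_abs_le_one hx
  · rw [hh_eq_kk h, kk, Complex.norm_real, Real.norm_eq_abs,
      abs_of_pos (one_div_pos.2 (by linarith [E_ge hx]))]
    have := one_div_le_one_div_of_le one_pos (by linarith [E_ge hx] : 1 ≤ Real.exp x - 1)
    simpa using this

lemma hh_loc : LocallyIntegrableOn hh (Ioi 0) := by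
  have h1 : LocallyIntegrableOn (fun _ : ℝ => (1:ℝ)) (Ioi 0) :=
    (locallyIntegrable_const (1:ℝ)).locallyIntegrableOn _
  intro x hx
  obtain ⟨U, hU, hi⟩ := h1 x hx
  refine ⟨U ∩ Ioi 0, inter_mem hU self_mem_nhdsWithin, ?_⟩
  refine Integrable.mono' (hi.mono_set inter_subset_left) hh_meas.aestronglyMeasurable ?_
  have : ∀ᵐ a ∂(volume.restrict (U ∩ Ioi (0:ℝ))), a ∈ Ioi (0:ℝ) := by
    refine ae_mono (Measure.restrict_mono inter_subset_right le_rfl) ?_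
    exact ae_restrict_mem measurableSet_Ioi
  filter_upwards [this] with a ha using hh_bound ha

lemma hh_top : hh =O[atTop] fun t => Real.exp (-1 * t) := by
  refine kk_top.congr' ?_ EventuallyEq.rfl
  filter_upwards [eventually_gt_atTop (1:ℝ)] with x hx using (hh_eq_kk hx).symm

lemma hh_bot : hh =O[𝓝[>] 0] (· ^ (-0 : ℝ)) := by
  refine Asymptotics.IsBigO.of_bound 1 ?_
  filter_upwards [self_mem_nhdsWithin] with x hx
  simpa using hh_bound hx

lemma hh_conv {s : ℂ} (hs : 0 < s.re) : MellinConvergent hh s :=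
  mellinConvergent_of_isBigO_rpow_exp one_pos hh_loc hh_top hh_bot hs

lemma hh_diff {s : ℂ} (hs : 0 < s.re) : DifferentiableAt ℂ (mellin hh) s :=
  mellin_differentiableAt_of_isBigO_rpow_exp one_pos hh_loc hh_top hh_bot hs

lemma hh_mellin_of_one_lt {s : ℂ} (hs : 1 < s.re) :
    mellin hh s = Complex.Gamma s * riemannZeta s - 1 / (s - 1) := by
  have h1 := hasMellin_cpow_Ioc (-1) (s := s) (by simp; linarith)
  have h2 := (hasMellin_sub (kk_conv hs) h1.1).2
  rw [h1.2, kk_mellin hs] at h2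
  rw [sub_eq_add_neg s 1, ← h2]
  rfl

lemma hh_mellin {s : ℂ} (hs : 0 < s.re) (hs1 : s ≠ 1) :
    mellin hh s = Complex.Gamma s * riemannZeta s - 1 / (s - 1) := by
  have hopen : IsOpen {z : ℂ | 0 < z.re} := isOpen_lt continuous_const continuous_re
  have hEq : EqOn (fun z => (z - 1) * mellin hh z + 1) (fun z => Complex.Gamma z * riemannZeta₁ z)
      {z : ℂ | 0 < z.re} := by
    refine AnalyticOnNhd.eqOn_of_preconnected_of_eventuallyEq (𝕜 := ℂ) (z₀ := 2) ?_ ?_ ?_ (by simp) ?_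
    · refine DifferentiableOn.analyticOnNhd (fun z hz => ?_) hopen
      have := hh_diff hz
      exact DifferentiableAt.differentiableWithinAt (by fun_prop)
    · refine DifferentiableOn.analyticOnNhd (fun z hz => ?_) hopen
      have : DifferentiableAt ℂ Complex.Gamma z := by
        refine differentiableAt_Gamma _ fun m hm => ?_
        have hz : 0 < z.re := hz
        rw [hm] at hz
        simp at hz
        have : (0:ℝ) ≤ m := m.cast_nonneg
        linarith
      exact DifferentiableAt.differentiableWithinAt (by fun_prop)
    · exact (convex_halfSpace_re_gt 0).isPreconnected
    · have hopen1 : IsOpen {z : ℂ | 1 < z.re} := isOpen_lt continuous_const continuous_re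
      filter_upwards [hopen1.mem_nhds (by simp : (2:ℂ) ∈ _)] with z hz
      have hz1 : z ≠ 1 := by rintro rfl; simp at hz
      have : z - 1 ≠ 0 := sub_ne_zero.2 hz1
      rw [hh_mellin_of_one_lt hz, riemannZeta_eq_inv_sub_mul hz1]
      field_simp
      ring
  have h := hEq hs
  have h0 : s - 1 ≠ 0 := sub_ne_zero.2 hs1
  rw [riemannZeta_eq_inv_sub_mul hs1]
  simp only at h
  field_simp
  linear_combination h

lemma ind_mellin {s : ℂ} (hs : s.re < 1) :
    HasMellin (indicator (Ioi 1) (fun t : ℝ => (t : ℂ) ^ (-1 : ℂ))) s (-(1 / (s - 1))) := by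
  have e : ∀ t ∈ Ioi (0:ℝ), (t : ℂ) ^ (s - 1) • indicator (Ioi (1:ℝ)) (fun t : ℝ => (t : ℂ) ^ (-1 : ℂ)) t
      = indicator (Ioi (1:ℝ)) (fun t : ℝ => (t : ℂ) ^ (s - 2)) t := by
    intro t ht
    by_cases h : t ∈ Ioi (1:ℝ)
    · rw [indicator_of_mem h, indicator_of_mem h, smul_eq_mul, ← cpow_add]
      · ring_nf
      · exact_mod_cast (mem_Ioi.1 ht).ne'
    · rw [indicator_of_notMem h, indicator_of_notMem h, smul_zero]
  have hs2 : (s - 2).re < -1 := by simp; linarith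
  have hsub : Ioi (0:ℝ) ∩ Ioi 1 = Ioi 1 := by
    rw [Ioi_inter_Ioi]; simp
  constructor
  · refine IntegrableOn.congr_fun ?_ (fun t ht => (e t ht).symm) measurableSet_Ioi
    rw [IntegrableOn, integrable_indicator_iff measurableSet_Ioi, IntegrableOn,
      Measure.restrict_restrict measurableSet_Ioi, inter_comm, hsub]
    exact integrableOn_Ioi_cpow_of_lt hs2 one_pos
  · rw [mellin, setIntegral_congr_fun measurableSet_Ioi e, setIntegral_indicator measurableSet_Ioi,
      hsub, integral_Ioi_cpow_of_lt hs2 one_pos]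
    simp
    ring_nf

lemma fr_mellin {s : ℂ} (hs : 0 < s.re) (hs1 : s.re < 1) :
    mellin (fun x => (fr x : ℂ)) s = Complex.Gamma s * riemannZeta s := by
  have h1 := ind_mellin hs1
  have h2 := (hasMellin_sub (hh_conv hs) h1.1).2
  rw [h1.2, hh_mellin hs (by rintro rfl; simp at hs1)] at h2
  have e : mellin (fun x => (fr x : ℂ)) s = mellin (fun t => hh t - 
      indicator (Ioi 1) (fun t : ℝ => (t : ℂ) ^ (-1 : ℂ)) t) s := by
    refine setIntegral_congr_fun measurableSet_Ioi fun x hx => ?_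
    simp only
    congr 1
    rcases le_or_gt x 1 with h | h
    · rw [hh_eq_fr ⟨hx, h⟩, indicator_of_notMem (by simpa using h), sub_zero]
    · rw [hh_eq_kk h, indicator_of_mem (by simpa using h), cpow_neg_one, kk, fr]
      push_cast; ring
  rw [e, h2]
  ring

/-! ### Fourier transform and inversion -/

open scoped FourierTransform Convolution

/-- The product `Γ(s) ζ(s)`. -/
def GZ (s : ℂ) : ℂ := Complex.Gamma s * riemannZeta s

lemma GG_fourier (v : ℝ) : 𝓕 GG v = GZ (1 / 2 + 2 * Real.pi * v * I) := by
  have hre : (1 / 2 + 2 * Real.pi * v * I : ℂ).re = 1 / 2 := by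
    simp [mul_re, mul_im]
  have him : (1 / 2 + 2 * Real.pi * v * I : ℂ).im = 2 * Real.pi * v := by
    simp [mul_re, mul_im]
  have h := mellin_eq_fourier (fun x => (fr x : ℂ)) (s := 1 / 2 + 2 * Real.pi * v * I)
  rw [fr_mellin (by rw [hre]; norm_num) (by rw [hre]; norm_num), hre, him,
    mul_div_cancel_left₀ v (by positivity)] at h
  rw [GZ, h]
  have e : GG = fun u : ℝ => Real.exp (-(1/2) * u) • (fr (Real.exp (-u)) : ℂ) := by
    ext u
    simp [GG]
  rw [e]

lemma GG_fourier_cont : Continuous (𝓕 GG) :=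
  VectorFourier.fourierIntegral_continuous Real.continuous_fourierChar
    (by exact continuous_inner) GG_int

lemma fourier_norm_le (f : ℝ → ℂ) (v : ℝ) : ‖𝓕 f v‖ ≤ ∫ u, ‖f u‖ :=
  VectorFourier.norm_fourierIntegral_le_integral_norm _ _ _ _ _

lemma GG_fourier_decay : ∃ K : ℝ, ∀ v : ℝ, ‖𝓕 GG v * 𝓕 GG (-v)‖ ≤ K * (1 + v ^ 2)⁻¹ := by
  set A := ∫ u, ‖GG u‖
  set B := ∫ u, ‖deriv GG u‖
  have hA : ∀ v, ‖𝓕 GG v‖ ≤ A := fourier_norm_le GG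
  have hB : ∀ v, |v| * ‖𝓕 GG v‖ ≤ B := by
    intro v
    have h1 := fourier_norm_le (deriv GG) v
    rw [Real.fourier_deriv GG_int GG_diff GG_deriv_int] at h1
    simp only [norm_smul, norm_mul, norm_I, Complex.norm_real, Real.norm_eq_abs, Complex.norm_ofNat,
      abs_of_pos Real.pi_pos, mul_one] at h1
    have h2 : 0 ≤ |v| * ‖𝓕 GG v‖ := by positivity
    have h3 := Real.pi_gt_three
    nlinarith
  have hA0 : 0 ≤ A := (norm_nonneg _).trans (hA 0)
  have hB0 : 0 ≤ B := le_trans (by positivity) (hB 0)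
  refine ⟨A ^ 2 + B ^ 2, fun v => ?_⟩
  rw [← div_eq_mul_inv, le_div_iff₀ (by positivity), norm_mul]
  have h1 : ‖𝓕 GG v‖ * ‖𝓕 GG (-v)‖ ≤ A * A := mul_le_mul (hA v) (hA _) (norm_nonneg _) hA0
  have h2 : (|v| * ‖𝓕 GG v‖) * (|v| * ‖𝓕 GG (-v)‖) ≤ B * B := by
    have := hB (-v)
    rw [abs_neg] at this
    exact mul_le_mul (hB v) this (by positivity) hB0
  have h3 : v ^ 2 = |v| * |v| := by rw [← sq, sq_abs]
  rw [h3]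
  nlinarith

lemma prod_int : Integrable (fun v : ℝ => 𝓕 GG v * 𝓕 GG (-v)) := by
  obtain ⟨K, hK⟩ := GG_fourier_decay
  refine (integrable_inv_one_add_sq.const_mul K).mono' ?_ (ae_of_all _ hK)
  exact (GG_fourier_cont.mul (GG_fourier_cont.comp continuous_neg)).aestronglyMeasurable

def HH (u : ℝ) : ℂ := GG (-u)

lemma HH_int : Integrable HH := GG_int.comp_neg

lemma HH_fourier (v : ℝ) : 𝓕 HH v = 𝓕 GG (-v) := by
  rw [← Real.fourierInv_eq_fourier_neg, Real.fourierInv_eq_fourier_comp_neg]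
  rfl

def CC : ℝ → ℂ := GG ⋆[ContinuousLinearMap.mul ℂ ℂ, volume] HH

lemma CC_cont : Continuous CC := by
  refine BddAbove.continuous_convolution_right_of_integrable _ ?_ GG_int (GG_cont.comp continuous_neg)
  refine ⟨1, ?_⟩
  rintro _ ⟨x, rfl⟩
  refine (GG_norm _).trans ?_
  rw [Real.exp_le_one_iff]
  have := abs_nonneg (-x)
  linarith

lemma CC_int : Integrable CC := GG_int.integrable_convolution _ HH_int

lemma CC_fourier : 𝓕 CC = fun v : ℝ => 𝓕 GG v * 𝓕 GG (-v) := by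
  ext v
  rw [CC, Real.fourier_mul_convolution_eq GG_int HH_int, HH_fourier]

lemma CC_eq (x : ℝ) : CC x = ∫ v : ℝ, cexp (2 * Real.pi * (v * x) * I) *
    (GZ (1 / 2 + 2 * Real.pi * v * I) * GZ (1 / 2 - 2 * Real.pi * v * I)) := by
  have h := congrFun (CC_cont.fourierInv_fourier_eq CC_int (by rw [CC_fourier]; exact prod_int)) x
  rw [← h, CC_fourier, Real.fourierInv_eq']
  congr 1
  ext v
  rw [GG_fourier, GG_fourier, smul_eq_mul]
  congr 2
  · push_cast
    simp [mul_comm]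
  · congr 1; push_cast; ring

lemma prodGZ_int : Integrable (fun v : ℝ =>
    GZ (1 / 2 + 2 * Real.pi * v * I) * GZ (1 / 2 - 2 * Real.pi * v * I)) := by
  convert prod_int using 2 with v
  rw [GG_fourier, GG_fourier]
  congr 2; push_cast; ring

lemma CC_two_mul (n : ℝ) : CC (2 * n) = ((∫ x in Ioi (0:ℝ),
    fr (x * Real.exp n) * fr (x * Real.exp (-n)) : ℝ) : ℂ) := by
  have h1 : CC (2 * n) = ∫ t, GG (t + n) * GG (t - n) := by
    rw [← integral_sub_right_eq_self _ n]
    have : CC (2 * n) = ∫ t, GG t * GG (-(2 * n - t)) := rfl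
    rw [this]
    congr 1; ext t; congr 2 <;> ring
  have h2 := mellin_eq_fourier (fun x => ((fr (x * Real.exp n) * fr (x * Real.exp (-n)) : ℝ) : ℂ))
    (s := 1)
  rw [Real.fourier_real_eq_integral_exp_smul] at h2
  have h3 : mellin (fun x => ((fr (x * Real.exp n) * fr (x * Real.exp (-n)) : ℝ) : ℂ)) 1
    = ((∫ x in Ioi (0:ℝ), fr (x * Real.exp n) * fr (x * Real.exp (-n)) : ℝ) : ℂ) := by
    rw [mellin, ← integral_complex_ofReal]
    simp
  rw [← h3, h2, h1]
  congr 1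
  ext t
  simp only [GG, one_re, one_im, zero_div, mul_zero, ofReal_zero, zero_mul, Complex.exp_zero, one_smul,
    ← Real.exp_add]
  rw [← ofReal_mul, real_smul, ← ofReal_mul]
  congr 1
  have e1 : Real.exp (-1 * t) = Real.exp (-(1/2) * (t + n)) * Real.exp (-(1/2) * (t - n)) := by
    rw [← Real.exp_add]; ring_nf
  have e2 : -(t + n) = -t + -n := by ring
  have e3 : -(t - n) = -t + n := by ring
  rw [e1, e2, e3]
  ring

/-! ### Final assembly -/

def AA (t : ℝ) : ℂ := GZ (1 / 2 + I * t / 2) * GZ (1 / 2 - I * t / 2)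

lemma AA_neg (t : ℝ) : AA (-t) = AA t := by
  unfold AA
  rw [mul_comm]
  push_cast
  congr 2 <;> ring

lemma AA_comp (v : ℝ) : AA (4 * Real.pi * v) =
    GZ (1 / 2 + 2 * Real.pi * v * I) * GZ (1 / 2 - 2 * Real.pi * v * I) := by
  unfold AA
  push_cast
  congr 2 <;> ring

lemma AA_int : Integrable AA := by
  have h : Integrable (fun v : ℝ => AA (4 * Real.pi * v)) := by
    simp_rw [AA_comp]; exact prodGZ_int
  exact (integrable_comp_mul_left_iff AA (by positivity : 4 * Real.pi ≠ 0)).1 h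

lemma AA_integral (n : ℝ) : ∫ t : ℝ, cexp (n * t * I) * AA t = 4 * Real.pi * CC (2 * n) := by
  have h := Measure.integral_comp_mul_left (fun t : ℝ => cexp (n * t * I) * AA t) (4 * Real.pi)
  simp_rw [AA_comp] at h
  have hC := CC_eq (2 * n)
  have e : ∀ v : ℝ, cexp (2 * Real.pi * (v * (2 * n : ℝ)) * I) = cexp (n * (4 * Real.pi * v : ℝ) * I) := by
    intro v; push_cast; congr 1; ring
  simp_rw [e] at hC
  rw [hC, h, abs_of_pos (by positivity), real_smul, ← mul_assoc]
  push_cast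
  have : (Real.pi : ℂ) ≠ 0 := by exact_mod_cast Real.pi_ne_zero
  rw [mul_inv_cancel₀ (by simpa using this), one_mul]

lemma AA_cos (n : ℝ) : ∫ t in Ioi (0:ℝ), AA t * Real.cos (n * t) = 2 * Real.pi * CC (2 * n) := by
  have hi : Integrable (fun t : ℝ => cexp (n * t * I) * AA t) := by
    refine AA_int.bdd_mul (c := 1) (by fun_prop) (ae_of_all _ fun t => ?_)
    have : (n * t * I : ℂ) = ((n * t : ℝ) : ℂ) * I := by push_cast; ring
    rw [this, norm_exp_ofReal_mul_I]
  have h1 := integral_add_compl (measurableSet_Ioi (a := (0:ℝ))) hi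
  rw [AA_integral, compl_Ioi] at h1
  have h2 := integral_comp_neg_Ioi 0 (fun t : ℝ => cexp (n * t * I) * AA t)
  rw [neg_zero] at h2
  rw [← h2, ← integral_add hi.integrableOn] at h1
  · have e : ∀ t : ℝ, cexp (n * t * I) * AA t + cexp (n * (-t : ℝ) * I) * AA (-t)
      = 2 * (AA t * Real.cos (n * t)) := by
      intro t
      rw [AA_neg]
      push_cast
      rw [Complex.cos]
      have : (n * -t * I : ℂ) = -(n * t) * I := by ring
      rw [this]; ring
    simp_rw [e] at h1
    rw [integral_const_mul] at h1
    linear_combination h1 / 2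
  · exact hi.comp_neg.integrableOn

lemma RiemannXi_eq {s : ℂ} (hs : 0 < s.re) :
    RiemannXi s = (1/2) * s * (s - 1) * completedRiemannZeta s := by
  have h0 : s ≠ 0 := by rintro rfl; simp at hs
  have h1 := Gammaℝ_ne_zero_of_re_pos hs
  rw [RiemannXi, riemannZeta_def_of_ne_zero h0, mul_assoc _ _ (Complex.Gamma (s / 2)), ← Gammaℝ_def]
  field_simp

lemma RiemannXi_symm {s : ℂ} (hs : 0 < s.re) (hs1 : s.re < 1) :
    RiemannXi (1 - s) = RiemannXi s := by
  rw [RiemannXi_eq hs, RiemannXi_eq (by simpa using hs1), completedRiemannZeta_one_sub]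
  ring

lemma pi_half_sq : (Real.pi : ℂ) ^ (1 / 2 : ℂ) * (Real.pi : ℂ) ^ (1 / 2 : ℂ) = Real.pi := by
  have : (Real.pi : ℂ) ≠ 0 := by exact_mod_cast Real.pi_ne_zero
  rw [← cpow_add _ _ this]; norm_num

lemma sqrt_pi_eq : ((√Real.pi : ℝ) : ℂ) = (Real.pi : ℂ) ^ (1 / 2 : ℂ) := by
  rw [Real.sqrt_eq_rpow, ofReal_cpow Real.pi_pos.le]; norm_num

lemma pointwise (t : ℝ) :
    Complex.Gamma ((-1 + I * t) / 4) * Complex.Gamma ((-1 - I * t) / 4) *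
          (RiemannBigXi (t / 2)) ^ 2 / (1 + (t:ℂ) ^ 2)
      = (Real.pi : ℂ) ^ (1 / 2 : ℂ) / 2 * AA t := by
  have hpi : (Real.pi : ℂ) ≠ 0 := by exact_mod_cast Real.pi_ne_zero
  have ht : (1 + (t:ℂ) ^ 2) ≠ 0 := by
    have : (1 + t ^ 2 : ℝ) ≠ 0 := by positivity
    exact_mod_cast this
  set s : ℂ := 1 / 2 + I * t / 2 with hs
  have hsre : s.re = 1 / 2 := by simp [hs]
  have hX : RiemannBigXi (t / 2) = RiemannXi s := by
    rw [RiemannBigXi, hs]; congr 1; ring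
  have hX2 : RiemannBigXi (t / 2) ^ 2 = RiemannXi s * RiemannXi (1 - s) := by
    rw [RiemannXi_symm (by rw [hsre]; norm_num) (by rw [hsre]; norm_num), hX, sq]
  have hAA : AA t = GZ s * GZ (1 - s) := by
    rw [AA, hs]; congr 2; ring
  have hx : ((-1 + I * t) / 4 : ℂ) ≠ 0 := by
    intro h; have := congrArg re h; simp at this
  have hy : ((-1 - I * t) / 4 : ℂ) ≠ 0 := by
    intro h; have := congrArg re h; simp at this
  have g1 := Complex.Gamma_add_one _ hx
  have g2 := Complex.Gamma_add_one _ hy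
  have e1 : ((-1 + I * t) / 4 + 1 : ℂ) = s / 2 + 1 / 2 := by rw [hs]; ring
  have e2 : ((-1 - I * t) / 4 + 1 : ℂ) = (1 - s) / 2 + 1 / 2 := by rw [hs]; ring
  rw [e1] at g1
  rw [e2] at g2
  have d1 := Complex.Gamma_mul_Gamma_add_half (s / 2)
  have d2 := Complex.Gamma_mul_Gamma_add_half ((1 - s) / 2)
  rw [mul_div_cancel₀ _ two_ne_zero, sqrt_pi_eq, g1] at d1
  rw [mul_div_cancel₀ _ two_ne_zero, sqrt_pi_eq, g2] at d2
  have p2 : (2 : ℂ) ^ (1 - s) * (2 : ℂ) ^ (1 - (1 - s)) = 2 := by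
    rw [← cpow_add _ _ two_ne_zero]; ring_nf; simp
  have pp : (Real.pi : ℂ) ^ (-s / 2) * (Real.pi : ℂ) ^ (-(1 - s) / 2) * (Real.pi : ℂ) ^ (1 / 2 : ℂ) = 1 := by
    rw [← cpow_add _ _ hpi, ← cpow_add _ _ hpi]; ring_nf; simp
  have hxy : ((-1 + I * t) / 4 : ℂ) * ((-1 - I * t) / 4) = (1 + (t:ℂ) ^ 2) / 16 := by
    linear_combination (-(t:ℂ)^2 / 16) * I_sq
  have hss : s * (s - 1) = -(1 + (t:ℂ) ^ 2) / 4 := by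
    rw [hs]; linear_combination ((t:ℂ)^2 / 4) * I_sq
  have psq := pi_half_sq
  rw [hX2, hAA]
  unfold RiemannXi GZ
  generalize Complex.Gamma ((-1 + I * t) / 4) = gx at *
  generalize Complex.Gamma ((-1 - I * t) / 4) = gy at *
  generalize Complex.Gamma (s / 2) = a at *
  generalize Complex.Gamma ((1 - s) / 2) = b at *
  generalize Complex.Gamma s = c at *
  generalize Complex.Gamma (1 - s) = d at *
  generalize riemannZeta s = z1
  generalize riemannZeta (1 - s) = z2
  generalize (2 : ℂ) ^ (1 - s) = q1 at *
  generalize (2 : ℂ) ^ (1 - (1 - s)) = q2 at *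
  generalize (Real.pi : ℂ) ^ (-s / 2) = r1 at *
  generalize (Real.pi : ℂ) ^ (-(1 - s) / 2) = r2 at *
  generalize (Real.pi : ℂ) ^ (1 / 2 : ℂ) = r at *
  generalize ((-1 + I * t) / 4 : ℂ) = x at *
  generalize ((-1 - I * t) / 4 : ℂ) = y at *
  have hr : r ≠ 0 := by rintro rfl; simp at pp
  generalize (1 + (t:ℂ) ^ 2) = T at *
  -- the product of the two duplication formulas
  have key : a * b * (gx * gy) * (T / 16) = 2 * (c * d) * r ^ 2 := by
    rw [← hxy]
    linear_combination (b * (y * gy)) * d1 + (c * q1 * r) * d2 + (c * d * r ^ 2) * p2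
  have hs4 : s * (s - 1) * ((1 - s) * (1 - s - 1)) = T ^ 2 / 16 := by
    linear_combination (s * (s - 1) - T / 4) * hss
  rw [div_eq_iff ht]
  have step : gx * gy * (1 / 2 * s * (s - 1) * r1 * a * z1 * (1 / 2 * (1 - s) * (1 - s - 1) * r2 * b * z2))
      = (r1 * r2) * (1 / 4) * T * (z1 * z2) * (2 * (c * d) * r ^ 2) := by
    rw [← key]
    linear_combination (gx * gy * r1 * r2 * a * b * z1 * z2 / 4) * hs4
  rw [step]
  linear_combination (T * z1 * z2 * c * d * r / 2) * pp

/-- Ramanujan's integral identity (equation (1.4) of Dixit–Kumar; Ramanujan 1915). -/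
theorem ramanujan_integral_identity (n : ℝ) (hn : 0 < n) :
    ∫ t in Ioi (0:ℝ),
        Complex.Gamma ((-1 + I * t) / 4) * Complex.Gamma ((-1 - I * t) / 4) *
          (RiemannBigXi (t / 2)) ^ 2 * Real.cos (n * t) / (1 + (t:ℂ) ^ 2)
  = (Real.pi : ℂ) ^ ((3:ℂ)/2) *
      ((∫ x in Ioi (0:ℝ),
          (1 / (Real.exp (x * Real.exp n) - 1) - 1 / (x * Real.exp n)) *
            (1 / (Real.exp (x * Real.exp (-n)) - 1) - 1 / (x * Real.exp (-n))) : ℝ) : ℂ) := by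
  have h1 : ∀ t : ℝ, Complex.Gamma ((-1 + I * t) / 4) * Complex.Gamma ((-1 - I * t) / 4) *
          (RiemannBigXi (t / 2)) ^ 2 * Real.cos (n * t) / (1 + (t:ℂ) ^ 2)
      = (Real.pi : ℂ) ^ (1 / 2 : ℂ) / 2 * (AA t * Real.cos (n * t)) := by
    intro t
    rw [← mul_assoc, ← pointwise]
    ring
  have h2 := CC_two_mul n
  unfold fr at h2
  simp_rw [h1]
  rw [integral_const_mul, AA_cos, ← h2]
  have hpi : (Real.pi : ℂ) ≠ 0 := by exact_mod_cast Real.pi_ne_zero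
  have h3 : (Real.pi : ℂ) ^ ((3:ℂ)/2) = Real.pi * (Real.pi : ℂ) ^ (1 / 2 : ℂ) := by
    rw [show (3:ℂ)/2 = 1 + 1/2 by norm_num, cpow_add _ _ hpi, cpow_one]
  rw [h3]
  ring
end
end

section
/- Let w ∈ ℂ, let z ∈ ℂ with −1 < Re(z) < 1, let c > −1 + |Re(z)|, and for x > 0 define ₁K_{z,w}(x) := (1/(2π)) ∫_{−∞}^∞ Γ((1+c+iτ−z)/2)·Γ((1+c+iτ+z)/2)·₁F₁((1+c+iτ−z)/2; 3/2; −w²/4)·₁F₁((1+c+iτ+z)/2; 3/2; −w²/4)·2^{c+iτ−1}·x^{−c−iτ} dτ. Then for every μ ∈ ℂ with Re(μ) > −1 + |Re(z)|, ∫_0^∞ x^{μ−1}·₁K_{z,w}(x) dx = 2^{μ−1}·Γ((1+μ−z)/2)·Γ((1+μ+z)/2)·₁F₁((1+μ−z)/2; 3/2; −w²/4)·₁F₁((1+μ+z)/2; 3/2; −w²/4). In particular, for integers k ≥ 1, ∫_0^∞ x^{z/2+2k−1}·₁K_{z/2,iw}(x) dx = 2^{z/2+2k−1}·Γ(k+1/2)·Γ((z+1)/2+k)·₁F₁((z+1)/2+k;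 3/2; w²/4)·₁F₁(1/2+k; 3/2; w²/4). -/
noncomputable section
open Complex MeasureTheory Set Filter Topology

/-- Pochhammer symbol `(a)_n`. -/
def poch (a : ℂ) (n : ℕ) : ℂ := (ascPochhammer ℂ n).eval a

/-- Confluent hypergeometric function `₁F₁(a; c; z)`. -/
def oneF1 (a c z : ℂ) : ℂ := ∑' n : ℕ, poch a n / poch c n * z ^ n / (n.factorial : ℂ)


/-- The generalized modified Bessel function `₁K_{z,w}(x)`, defined by an inverse Mellin
transform along the vertical line `Re(s) = c`, parametrized as `s = c + iτ`. -/
def oneK (z w : ℂ) (c : ℝ) (x : ℝ) : ℂ :=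
  (1 / (2 * Real.pi)) *
    ∫ τ : ℝ,
      Complex.Gamma ((1 + (c + I * τ) - z) / 2) * Complex.Gamma ((1 + (c + I * τ) + z) / 2) *
        oneF1 ((1 + (c + I * τ) - z) / 2) (3/2) (-w ^ 2 / 4) *
        oneF1 ((1 + (c + I * τ) + z) / 2) (3/2) (-w ^ 2 / 4) *
        (2:ℂ) ^ ((c + I * τ) - 1) * (x:ℂ) ^ (-(c + I * τ))

/-- Coefficients of the series `₀F₁(; 3/2; v t)`. -/
def cf (v : ℂ) (n : ℕ) : ℂ := v ^ n / (poch (3/2) n * (n.factorial : ℂ))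

/-- `e^{-t} ₀F₁(; 3/2; v t)`. -/
def phi (v : ℂ) (t : ℝ) : ℂ := ∑' n : ℕ, cf v n * ((t ^ n * Real.exp (-t) : ℝ) : ℂ)

lemma poch_succ (a : ℂ) (n : ℕ) : poch a (n + 1) = poch a n * (a + n) := by
  simp [poch, ascPochhammer_succ_eval]

lemma poch_Gamma (a : ℂ) (ha : 0 < a.re) (n : ℕ) :
    Complex.Gamma (a + n) = poch a n * Complex.Gamma a := by
  induction n with
  | zero => simp [poch]
  | succ n ih =>
    have h : a + n ≠ 0 := by
      intro h
      have := congrArg Complex.re h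
      simp at this
      have h2 : (0:ℝ) ≤ n := n.cast_nonneg
      linarith
    rw [poch_succ, Nat.cast_succ, ← add_assoc, Complex.Gamma_add_one _ h, ih]
    ring

lemma cf_succ_norm (v : ℂ) (n : ℕ) :
    ‖cf v (n + 1)‖ = ‖cf v n‖ * (‖v‖ / ((3/2 + n) * (n + 1))) := by
  have h1 : ‖(3/2 : ℂ) + n‖ = 3/2 + n := by
    have : (3/2 : ℂ) + n = ((3/2 + n : ℝ) : ℂ) := by push_cast; ring
    rw [this, Complex.norm_real, Real.norm_of_nonneg (by positivity)]
  have h2 : ‖(n : ℂ) + 1‖ = n + 1 := by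
    have : (n : ℂ) + 1 = ((n + 1 : ℝ) : ℂ) := by push_cast; ring
    rw [this, Complex.norm_real, Real.norm_of_nonneg (by positivity)]
  have : cf v (n + 1) = cf v n * (v / ((3/2 + n) * (n + 1))) := by
    rw [cf, cf, poch_succ, Nat.factorial_succ, pow_succ]
    push_cast
    rw [div_mul_div_comm]
    ring
  rw [this]
  simp only [norm_mul, norm_div, h1, h2]

lemma summ (v : ℂ) (σ : ℝ) (hσ : 0 < σ) :
    Summable fun n : ℕ => ‖cf v n‖ * Real.Gamma (σ + n) := by
  apply summable_of_ratio_norm_eventually_le (r := 1/2) (by norm_num)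
  filter_upwards [eventually_ge_atTop (⌈σ⌉₊ + ⌈4 * ‖v‖⌉₊ + 1)] with n hn
  have h1 : (⌈σ⌉₊ : ℝ) + ⌈4 * ‖v‖⌉₊ + 1 ≤ n := by exact_mod_cast hn
  have h2 := Nat.le_ceil σ
  have h3 := Nat.le_ceil (4 * ‖v‖)
  have h4 : (0:ℝ) ≤ ⌈σ⌉₊ := Nat.cast_nonneg _
  have h5 : (0:ℝ) ≤ ⌈4 * ‖v‖⌉₊ := Nat.cast_nonneg _
  have hG : 0 < Real.Gamma (σ + n) := Real.Gamma_pos_of_pos (by linarith)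
  have hs : (σ + ((n + 1 : ℕ) : ℝ)) = (σ + n) + 1 := by push_cast; ring
  rw [hs, Real.Gamma_add_one (by linarith), cf_succ_norm]
  rw [Real.norm_of_nonneg (by positivity), Real.norm_of_nonneg (by positivity)]
  have key : ‖v‖ / ((3/2 + n) * (n + 1)) * (σ + n) ≤ 1 / 2 := by
    rw [div_mul_eq_mul_div, div_le_iff₀ (by positivity)]
    have hv : ‖v‖ ≤ n / 4 := by linarith
    have hn' : σ + n ≤ 2 * n := by linarith
    calc ‖v‖ * (σ + n) ≤ n / 4 * (2 * n) := by gcongr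
      _ ≤ _ := by nlinarith
  calc _ = (‖v‖ / ((3/2 + n) * (n + 1)) * (σ + n)) * (‖cf v n‖ * Real.Gamma (σ + n)) := by ring
    _ ≤ _ := by gcongr

lemma GF (v a : ℂ) (ha : 0 < a.re) :
    Complex.Gamma a * oneF1 a (3/2) v = ∑' n : ℕ, cf v n * Complex.Gamma (a + n) := by
  rw [oneF1, ← tsum_mul_left]
  congr 1; ext n
  rw [poch_Gamma a ha, cf]
  simp only [div_eq_mul_inv, mul_inv]
  ring

lemma norm_Gamma_le' (a : ℂ) (ha : 0 < a.re) : ‖Complex.Gamma a‖ ≤ Real.Gamma a.re := by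
  rw [Complex.Gamma_eq_integral ha, Real.Gamma_eq_integral ha, Complex.GammaIntegral]
  refine (norm_integral_le_integral_norm _).trans (le_of_eq ?_)
  refine setIntegral_congr_fun measurableSet_Ioi fun t ht => ?_
  have ht : 0 < t := ht
  simp only [norm_mul, Complex.norm_cpow_eq_rpow_re_of_pos ht, Complex.norm_real,
    Real.norm_of_nonneg (Real.exp_pos _).le]
  simp

lemma GF_bound (v : ℂ) (σ : ℝ) (hσ : 0 < σ) : ∃ C, 0 ≤ C ∧ ∀ a : ℂ, a.re = σ →
    ‖Complex.Gamma a * oneF1 a (3/2) v‖ ≤ C / ‖a‖ := by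
  refine ⟨∑' n : ℕ, ‖cf v n‖ * Real.Gamma (σ + 1 + n), tsum_nonneg fun n => ?_, fun a ha => ?_⟩
  · have : 0 < Real.Gamma (σ + 1 + n) := Real.Gamma_pos_of_pos (by positivity)
    positivity
  rw [GF v a (by linarith), ← tsum_div_const]
  refine tsum_of_norm_bounded ((summ v (σ + 1) (by linarith)).div_const _).hasSum fun n => ?_
  rw [norm_mul, mul_div_assoc]
  gcongr
  have han : 0 < (a + n).re := by simp [ha]; positivity
  have hne : a + n ≠ 0 := by intro h; simp [h] at han
  have hn0 : a ≠ 0 := by rintro rfl; simp at ha; linarith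
  have h1 := norm_Gamma_le' (a + n + 1) (by simp at han ⊢; linarith)
  rw [Complex.Gamma_add_one _ hne, norm_mul] at h1
  have h2 : ‖a‖ ≤ ‖a + n‖ := by
    rw [← sq_le_sq₀ (norm_nonneg _) (norm_nonneg _), Complex.sq_norm, Complex.sq_norm,
      Complex.normSq_apply, Complex.normSq_apply]
    simp
    have : (0:ℝ) ≤ n := n.cast_nonneg
    nlinarith
  rw [le_div_iff₀ (norm_pos_iff.2 hn0)]
  have e : (a + n + 1).re = σ + 1 + n := by simp [ha]; ring
  rw [e] at h1
  calc _ = ‖a‖ * ‖Complex.Gamma (a + n)‖ := by ring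
    _ ≤ _ := by gcongr
    _ ≤ _ := h1

lemma term_bound (n m : ℕ) (t : ℝ) (ht : 0 < t) :
    t ^ n * Real.exp (-t) ≤ Real.Gamma ((m + 1 : ℝ) + n) * t ^ (-(m:ℝ)) := by
  have h : Real.Gamma ((m + 1 : ℝ) + n) = ((m + n).factorial : ℝ) := by
    rw [← Real.Gamma_nat_eq_factorial]; push_cast; ring_nf
  have h2 := Real.pow_div_factorial_le_exp (x := t) ht.le (m + n)
  rw [div_le_iff₀ (by positivity)] at h2
  rw [h, Real.rpow_neg ht.le, Real.rpow_natCast, Real.exp_neg, ← div_eq_mul_inv, ← div_eq_mul_inv,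
    div_le_div_iff₀ (Real.exp_pos _) (by positivity), ← pow_add, add_comm n m]
  linarith

lemma phi_bound (v : ℂ) (m : ℕ) : ∃ C, ∀ t : ℝ, 0 < t → ‖phi v t‖ ≤ C * t ^ (-(m:ℝ)) := by
  refine ⟨∑' n : ℕ, ‖cf v n‖ * Real.Gamma ((m + 1 : ℝ) + n), fun t ht => ?_⟩
  rw [← tsum_mul_right]
  refine tsum_of_norm_bounded ((summ v (m + 1) (by positivity)).mul_right _).hasSum fun n => ?_
  rw [norm_mul, Complex.norm_real, Real.norm_of_nonneg (by positivity), mul_assoc]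
  exact mul_le_mul_of_nonneg_left (term_bound n m t ht) (norm_nonneg _)

lemma phi_cont (v : ℂ) : ContinuousOn (phi v) (Ioi 0) := by
  refine continuousOn_tsum (u := fun n : ℕ => ‖cf v n‖ * Real.Gamma (1 + n)) (fun n => ?_)
    (summ v 1 one_pos) fun n t ht => ?_
  · fun_prop
  · rw [norm_mul, Complex.norm_real, Real.norm_of_nonneg (by have : 0 < t := ht; positivity)]
    refine mul_le_mul_of_nonneg_left ?_ (norm_nonneg _)
    simpa using term_bound n 0 t ht

lemma phi_conv (v s : ℂ) (hs : 0 < s.re) : MellinConvergent (phi v) s := by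
  obtain ⟨m, hm⟩ := exists_nat_gt s.re
  refine mellinConvergent_of_isBigO_rpow (a := m) (b := 0)
    ((phi_cont v).locallyIntegrableOn measurableSet_Ioi) ?_ hm ?_ hs
  · obtain ⟨C, hC⟩ := phi_bound v m
    refine Asymptotics.IsBigO.of_bound C ?_
    filter_upwards [eventually_gt_atTop 0] with t ht
    rw [Real.norm_of_nonneg (by positivity)]
    exact hC t ht
  · obtain ⟨C, hC⟩ := phi_bound v 0
    refine Asymptotics.IsBigO.of_bound C ?_
    filter_upwards [self_mem_nhdsWithin] with t ht
    have ht : 0 < t := ht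
    rw [Real.norm_of_nonneg (by positivity)]
    simpa using hC t ht

lemma phi_mellin (v a : ℂ) (ha : 0 < a.re) :
    mellin (phi v) a = Complex.Gamma a * oneF1 a (3/2) v := by
  have hre : ∀ n : ℕ, 0 < (a + n).re := fun n => by simp; positivity
  have hEq : ∀ n : ℕ, ∀ t ∈ Ioi (0:ℝ), cf v n * (((Real.exp (-t) : ℝ) : ℂ) * (t:ℂ) ^ (a + n - 1)) =
      (t:ℂ) ^ (a - 1) * (cf v n * ((t ^ n * Real.exp (-t) : ℝ) : ℂ)) := by
    intro n t ht
    have ht : (t:ℂ) ≠ 0 := by exact_mod_cast (ne_of_gt ht)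
    have : a + n - 1 = (a - 1) + n := by ring
    rw [this, Complex.cpow_add _ _ ht, Complex.cpow_natCast]
    push_cast; ring
  have hnorm : ∀ n : ℕ, ∫ t in Ioi (0:ℝ),
      ‖cf v n * (((Real.exp (-t) : ℝ) : ℂ) * (t:ℂ) ^ (a + n - 1))‖ =
      ‖cf v n‖ * Real.Gamma (a.re + n) := by
    intro n
    rw [Real.Gamma_eq_integral (by simpa using hre n), ← integral_const_mul]
    refine setIntegral_congr_fun measurableSet_Ioi fun t ht => ?_
    have ht : 0 < t := ht
    simp only [norm_mul, Complex.norm_cpow_eq_rpow_re_of_pos ht, Complex.norm_real,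
      Real.norm_of_nonneg (Real.exp_pos _).le]
    simp
  have := hasSum_integral_of_summable_integral_norm (μ := volume.restrict (Ioi (0:ℝ)))
    (F := fun (n : ℕ) (t : ℝ) => cf v n * (((Real.exp (-t) : ℝ) : ℂ) * (t:ℂ) ^ (a + n - 1)))
    (fun n => (Complex.GammaIntegral_convergent (hre n)).const_mul _)
    (by simp_rw [hnorm]; exact summ v a.re ha)
  rw [GF v a ha]
  have e : ∀ n : ℕ, ∫ t in Ioi (0:ℝ), cf v n * (((Real.exp (-t) : ℝ) : ℂ) * (t:ℂ) ^ (a + n - 1)) =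
      cf v n * Complex.Gamma (a + n) := by
    intro n
    rw [integral_const_mul, Complex.Gamma_eq_integral (hre n), Complex.GammaIntegral]
  simp_rw [e] at this
  rw [this.tsum_eq, mellin]
  refine setIntegral_congr_fun measurableSet_Ioi fun t ht => ?_
  simp only [smul_eq_mul, phi]
  rw [← tsum_mul_left]
  exact tsum_congr fun n => (hEq n t ht).symm

lemma phi_diff (v s : ℂ) (hs : 0 < s.re) : DifferentiableAt ℂ (mellin (phi v)) s := by
  obtain ⟨m, hm⟩ := exists_nat_gt s.re
  refine mellin_differentiableAt_of_isBigO_rpow (a := m) (b := 0)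
    ((phi_cont v).locallyIntegrableOn measurableSet_Ioi) ?_ hm ?_ hs
  · obtain ⟨C, hC⟩ := phi_bound v m
    refine Asymptotics.IsBigO.of_bound C ?_
    filter_upwards [eventually_gt_atTop 0] with t ht
    rw [Real.norm_of_nonneg (by positivity)]
    exact hC t ht
  · obtain ⟨C, hC⟩ := phi_bound v 0
    refine Asymptotics.IsBigO.of_bound C ?_
    filter_upwards [self_mem_nhdsWithin] with t ht
    have ht : 0 < t := ht
    rw [Real.norm_of_nonneg (by positivity)]
    simpa using hC t ht

/-- Multiplicative convolution on `(0, ∞)`. -/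
def mconv (g₁ g₂ : ℝ → ℂ) (x : ℝ) : ℂ := ∫ y in Ioi (0:ℝ), g₁ (y⁻¹ * x) * (g₂ y * (y:ℂ)⁻¹)

lemma mconv_mellin (g₁ g₂ : ℝ → ℂ) (hg₁ : ContinuousOn g₁ (Ioi 0)) (hg₂ : ContinuousOn g₂ (Ioi 0))
    (s : ℂ) (h₁ : MellinConvergent g₁ s) (h₂ : MellinConvergent g₂ s) :
    MellinConvergent (mconv g₁ g₂) s ∧ mellin (mconv g₁ g₂) s = mellin g₁ s * mellin g₂ s := by
  let H : ℝ × ℝ → ℂ := fun p => (p.1:ℂ) ^ (s - 1) * (g₁ (p.2⁻¹ * p.1) * (g₂ p.2 * (p.2:ℂ)⁻¹))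
  have hmeas : AEStronglyMeasurable H
      ((volume.restrict (Ioi (0:ℝ))).prod (volume.restrict (Ioi (0:ℝ)))) := by
    rw [Measure.prod_restrict]
    refine ContinuousOn.aestronglyMeasurable ?_ (measurableSet_Ioi.prod measurableSet_Ioi)
    have c1 : ContinuousOn (fun p : ℝ × ℝ => (p.1:ℂ) ^ (s - 1)) (Ioi 0 ×ˢ Ioi 0) := by
      intro p hp
      refine ContinuousAt.continuousWithinAt ?_
      have : ContinuousAt (fun x : ℝ => (x:ℂ) ^ (s - 1)) p.1 :=
        Complex.continuousAt_ofReal_cpow_const _ _ (Or.inr (ne_of_gt hp.1))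
      exact ContinuousAt.comp (f := Prod.fst) (x := p) this continuousAt_fst
    have c2 : ContinuousOn (fun p : ℝ × ℝ => p.2⁻¹ * p.1) (Ioi 0 ×ˢ Ioi 0) :=
      (continuousOn_snd.inv₀ fun p hp => ne_of_gt hp.2).mul continuousOn_fst
    have c3 : ContinuousOn (fun p : ℝ × ℝ => g₁ (p.2⁻¹ * p.1)) (Ioi 0 ×ˢ Ioi 0) :=
      hg₁.comp c2 fun p hp => mem_Ioi.2 (mul_pos (inv_pos.2 hp.2) hp.1)
    have c4 : ContinuousOn (fun p : ℝ × ℝ => g₂ p.2) (Ioi 0 ×ˢ Ioi 0) :=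
      hg₂.comp continuousOn_snd fun p hp => hp.2
    have c5 : ContinuousOn (fun p : ℝ × ℝ => (p.2:ℂ)⁻¹) (Ioi 0 ×ˢ Ioi 0) :=
      ContinuousOn.inv₀ (by fun_prop) fun p hp => by
        have : p.2 ≠ 0 := ne_of_gt hp.2
        exact_mod_cast this
    exact c1.mul (c3.mul (c4.mul c5))
  have hint : ∀ y ∈ Ioi (0:ℝ), Integrable (fun x => H (x, y)) (volume.restrict (Ioi 0)) := by
    intro y hy
    have := (MellinConvergent.comp_mul_left (f := g₁) (s := s) (inv_pos.2 hy)).2 h₁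
    have := Integrable.mul_const this (g₂ y * (y:ℂ)⁻¹)
    refine this.congr (Eventually.of_forall fun x => ?_)
    simp only [H, smul_eq_mul]; ring
  have hval : ∀ y ∈ Ioi (0:ℝ), ∫ x in Ioi (0:ℝ), H (x, y) =
      mellin g₁ s * ((y:ℂ) ^ (s - 1) • g₂ y) := by
    intro y hy
    have hy : 0 < y := hy
    have hy0 : (y:ℂ) ≠ 0 := by exact_mod_cast hy.ne'
    have := mellin_comp_mul_left g₁ s (inv_pos.2 hy)
    rw [mellin] at this
    have e : ∀ x : ℝ, H (x, y) = ((x:ℂ) ^ (s - 1) • g₁ (y⁻¹ * x)) * (g₂ y * (y:ℂ)⁻¹) := by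
      intro x; simp only [H, smul_eq_mul]; ring
    simp_rw [e]
    rw [integral_mul_const, this, Complex.cpow_sub _ _ hy0, Complex.ofReal_inv,
      Complex.inv_cpow _ _ (by rw [Complex.arg_ofReal_of_nonneg hy.le]; exact Real.pi_pos.ne),
      Complex.cpow_neg, inv_inv, Complex.cpow_one]
    simp only [smul_eq_mul, div_eq_mul_inv]; ring
  have hnorm : ∀ y ∈ Ioi (0:ℝ), ∫ x in Ioi (0:ℝ), ‖H (x, y)‖ =
      (∫ u in Ioi (0:ℝ), ‖(u:ℂ) ^ (s - 1) • g₁ u‖) * ‖(y:ℂ) ^ (s - 1) • g₂ y‖ := by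
    intro y hy
    have hy : 0 < y := hy
    have := integral_comp_mul_left_Ioi (fun u : ℝ => ‖(u:ℂ) ^ (s - 1) • g₁ u‖) 0 (inv_pos.2 hy)
    rw [mul_zero, inv_inv, smul_eq_mul] at this
    have h2 : (∫ u in Ioi (0:ℝ), ‖(u:ℂ) ^ (s - 1) • g₁ u‖) = y⁻¹ *
      ∫ x in Ioi (0:ℝ), ‖((y⁻¹ * x : ℝ):ℂ) ^ (s - 1) • g₁ (y⁻¹ * x)‖ := by
      rw [this]; field_simp
    rw [h2, mul_right_comm, ← integral_const_mul]
    refine setIntegral_congr_fun measurableSet_Ioi fun x hx => ?_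
    have hx : 0 < x := hx
    have hyx : 0 < y⁻¹ * x := by positivity
    simp only [H, smul_eq_mul, norm_mul, Complex.norm_cpow_eq_rpow_re_of_pos hx,
      Complex.norm_cpow_eq_rpow_re_of_pos hy, Complex.norm_cpow_eq_rpow_re_of_pos hyx, norm_inv,
      Complex.norm_real, Real.norm_of_nonneg hy.le]
    rw [Real.mul_rpow (by positivity) hx.le, Real.inv_rpow hy.le]
    have : y ^ (s - 1).re ≠ 0 := (Real.rpow_pos_of_pos hy _).ne'
    field_simp
  have hH : Integrable H ((volume.restrict (Ioi (0:ℝ))).prod (volume.restrict (Ioi (0:ℝ)))) := by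
    rw [integrable_prod_iff' hmeas]
    refine ⟨(ae_restrict_iff' measurableSet_Ioi).2 (Eventually.of_forall hint), ?_⟩
    refine (Integrable.const_mul (Integrable.norm h₂)
      (∫ u in Ioi (0:ℝ), ‖(u:ℂ) ^ (s - 1) • g₁ u‖)).congr ?_
    exact (ae_restrict_iff' measurableSet_Ioi).2 (Eventually.of_forall fun y hy => (hnorm y hy).symm)
  have hx : ∀ x : ℝ, ∫ y in Ioi (0:ℝ), H (x, y) = (x:ℂ) ^ (s - 1) • mconv g₁ g₂ x := by
    intro x
    simp only [H, mconv, smul_eq_mul]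
    rw [integral_const_mul]
  constructor
  · have := hH.integral_prod_left
    simp_rw [hx] at this
    exact this
  · have h1 := integral_prod _ hH
    have h2 := integral_prod_symm _ hH
    rw [h1] at h2
    simp_rw [hx] at h2
    rw [mellin, h2, setIntegral_congr_fun measurableSet_Ioi hval, integral_const_mul]
    rfl

lemma mconv_cont (g₁ g₂ : ℝ → ℂ) (hg₁ : ContinuousOn g₁ (Ioi 0)) (hg₂ : ContinuousOn g₂ (Ioi 0))
    (κ C : ℝ) (hC : ∀ u, 0 < u → ‖g₁ u‖ ≤ C * u ^ (-κ)) (h₂ : MellinConvergent g₂ κ)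
    (x₀ : ℝ) (hx₀ : 0 < x₀) : ContinuousAt (mconv g₁ g₂) x₀ := by
  have hC0 : 0 ≤ C := by simpa using (norm_nonneg _).trans (hC 1 one_pos)
  have hev : ∀ᶠ x in 𝓝 x₀, 0 < x := lt_mem_nhds hx₀
  have c5 : ContinuousOn (fun y : ℝ => (y:ℂ)⁻¹) (Ioi 0) :=
      ContinuousOn.inv₀ (by fun_prop) fun p hp => by
        have : p ≠ 0 := ne_of_gt hp
        exact_mod_cast this
  refine continuousAt_of_dominated
    (bound := fun y => C * (x₀ ^ (-κ) + 1) * ‖(y:ℂ) ^ ((κ:ℂ) - 1) • g₂ y‖) ?_ ?_ ?_ ?_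
  · filter_upwards [hev] with x hx
    refine ContinuousOn.aestronglyMeasurable ?_ measurableSet_Ioi
    refine ContinuousOn.mul (hg₁.comp ?_ fun y hy => mul_pos (inv_pos.2 hy) hx) (hg₂.mul c5)
    exact (continuousOn_id.inv₀ fun p hp => ne_of_gt hp).mul continuousOn_const
  · have h : ∀ᶠ x in 𝓝 x₀, x ^ (-κ) < x₀ ^ (-κ) + 1 :=
      (Real.continuousAt_rpow_const x₀ (-κ) (Or.inl hx₀.ne')).eventually_lt continuousAt_const
        (by simp)
    filter_upwards [hev, h] with x hx hxx
    refine (ae_restrict_iff' measurableSet_Ioi).2 (Eventually.of_forall fun y hy => ?_)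
    have hy : 0 < y := hy
    rw [norm_mul, norm_mul, norm_smul, Complex.norm_cpow_eq_rpow_re_of_pos hy, norm_inv,
      Complex.norm_real, Real.norm_of_nonneg hy.le]
    have e : ((κ:ℂ) - 1).re = κ - 1 := by simp
    rw [e]
    calc ‖g₁ (y⁻¹ * x)‖ * (‖g₂ y‖ * y⁻¹)
        ≤ (C * (y⁻¹ * x) ^ (-κ)) * (‖g₂ y‖ * y⁻¹) := by
          gcongr
          exact hC _ (by positivity)
      _ = C * x ^ (-κ) * (y ^ (κ - 1) * ‖g₂ y‖) := by
          rw [Real.mul_rpow (by positivity) hx.le, Real.inv_rpow hy.le, Real.rpow_neg hy.le, inv_inv,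
            Real.rpow_sub hy, Real.rpow_one, div_eq_mul_inv]
          ring
      _ ≤ _ := by gcongr
  · exact (Integrable.norm h₂).const_mul _
  · refine (ae_restrict_iff' measurableSet_Ioi).2 (Eventually.of_forall fun y hy => ?_)
    have hy : 0 < y := hy
    refine ContinuousAt.mul ?_ continuousAt_const
    have : ContinuousAt g₁ (y⁻¹ * x₀) := hg₁.continuousAt (Ioi_mem_nhds (by positivity))
    exact ContinuousAt.comp (f := fun x => y⁻¹ * x) this (by fun_prop)

lemma integrable_inv_sq (a : ℂ) (ha : 0 < a.re) :
    Integrable fun τ : ℝ => (‖a + τ * I / 2‖ ^ 2)⁻¹ := by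
  have h1 : Integrable fun τ : ℝ => (1 + (τ + a.im / a.re) ^ 2)⁻¹ :=
    integrable_inv_one_add_sq.comp_add_right (a.im / a.re)
  have h2 := (h1.comp_mul_left' (R := (2 * a.re)⁻¹) (by positivity)).const_mul (a.re ^ 2)⁻¹
  refine h2.congr (Eventually.of_forall fun τ => ?_)
  simp only []
  rw [Complex.sq_norm, Complex.normSq_apply, ← mul_inv]
  congr 1
  simp
  field_simp
  ring

/-- The two convolution factors. -/
def gg (v z : ℂ) (u : ℝ) : ℂ := (u:ℂ) ^ (1 - z) • phi v (u ^ (2:ℝ))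

lemma gg_cont (v z : ℂ) : ContinuousOn (gg v z) (Ioi 0) := by
  have c1 : ContinuousOn (fun u : ℝ => (u:ℂ) ^ (1 - z)) (Ioi 0) := by
    intro p hp
    exact (Complex.continuousAt_ofReal_cpow_const _ _ (Or.inr (ne_of_gt hp))).continuousWithinAt
  have c2 : ContinuousOn (fun u : ℝ => phi v (u ^ (2:ℝ))) (Ioi 0) := by
    refine (phi_cont v).comp ?_ fun u hu => Real.rpow_pos_of_pos hu _
    exact continuousOn_id.rpow_const fun x hx => Or.inl (ne_of_gt hx)
  exact c1.smul c2

lemma gg_conv (v z s : ℂ) (h : 0 < (1 + s - z).re) : MellinConvergent (gg v z) s := by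
  refine MellinConvergent.cpow_smul.2 ?_
  refine (MellinConvergent.comp_rpow (f := phi v) (two_ne_zero)).2 (phi_conv v _ ?_)
  have : (s + (1 - z)) / ((2:ℝ):ℂ) = (((1/2 : ℝ) : ℂ)) * (1 + s - z) := by push_cast; ring
  rw [this, Complex.re_ofReal_mul]; linarith

lemma gg_mellin (v z s : ℂ) :
    mellin (gg v z) s = 1 / 2 * mellin (phi v) ((1 + s - z) / 2) := by
  unfold gg
  rw [mellin_cpow_smul (fun u : ℝ => phi v (u ^ (2:ℝ))), mellin_comp_rpow]
  have : (s + (1 - z)) / ((2:ℝ):ℂ) = (1 + s - z) / 2 := by push_cast; ring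
  rw [this]
  simp

lemma gg_bound (v z : ℂ) : ∃ C, ∀ u, 0 < u → ‖gg v z u‖ ≤ C * u ^ (-(1 + z.re)) := by
  obtain ⟨C, hC⟩ := phi_bound v 1
  refine ⟨C, fun u hu => ?_⟩
  have h := hC (u ^ (2:ℝ)) (by positivity)
  rw [gg, norm_smul, Complex.norm_cpow_eq_rpow_re_of_pos hu]
  calc _ ≤ u ^ (1 - z).re * (C * (u ^ (2:ℝ)) ^ (-((1:ℕ):ℝ))) := by gcongr
    _ = C * (u ^ (1 - z).re * (u ^ (2:ℝ)) ^ (-((1:ℕ):ℝ))) := by ring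
    _ = _ := by
      rw [← Real.rpow_mul hu.le, ← Real.rpow_add hu]
      congr 2
      simp; ring

/-- The explicit form of `₁K`. -/
def ff (v z : ℂ) (x : ℝ) : ℂ := (2:ℂ) • mconv (gg v z) (gg v (-z)) ((1/2) * x)

lemma ff_mellin (v z s : ℂ) (h1 : 0 < (1 + s - z).re) (h2 : 0 < (1 + s + z).re) :
    MellinConvergent (ff v z) s ∧ mellin (ff v z) s =
      (2:ℂ) ^ (s - 1) * mellin (phi v) ((1 + s - z) / 2) * mellin (phi v) ((1 + s + z) / 2) := by
  obtain ⟨hc, hm⟩ := mconv_mellin (gg v z) (gg v (-z)) (gg_cont v z) (gg_cont v (-z)) s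
    (gg_conv v z s h1) (gg_conv v (-z) s (by simpa using h2))
  have h12 : (0:ℝ) < 1 / 2 := by norm_num
  constructor
  · exact ((MellinConvergent.comp_mul_left h12).2 hc).const_smul (2:ℂ)
  · unfold ff
    rw [mellin_const_smul, mellin_comp_mul_left _ _ h12, hm, gg_mellin, gg_mellin, sub_neg_eq_add]
    have : ((1/2 : ℝ):ℂ) ^ (-s) = (2:ℂ) ^ s := by
      rw [one_div, Complex.ofReal_inv, Complex.inv_cpow _ _ (by
        rw [Complex.arg_ofReal_of_nonneg (by norm_num)]; exact Real.pi_pos.ne), Complex.cpow_neg,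
        inv_inv]
      simp
    rw [this, Complex.cpow_sub _ _ two_ne_zero, Complex.cpow_one]
    simp only [smul_eq_mul]
    ring

lemma ff_cont (v z : ℂ) (hz1 : -1 < z.re) (x : ℝ) (hx : 0 < x) :
    ContinuousAt (ff v z) x := by
  obtain ⟨C, hC⟩ := gg_bound v z
  have := mconv_cont (gg v z) (gg v (-z)) (gg_cont v z) (gg_cont v (-z)) (1 + z.re) C hC
    (gg_conv v (-z) _ (by simp; linarith)) ((1/2) * x) (by positivity)
  refine ContinuousAt.const_smul (c := (2:ℂ)) ?_
  exact ContinuousAt.comp (f := fun x : ℝ => (1/2) * x) this (by fun_prop)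

lemma ff_vert (v z : ℂ) (c : ℝ) (hc : -1 + |z.re| < c) :
    Complex.VerticalIntegrable (mellin (ff v z)) c := by
  have hz1 := le_abs_self z.re
  have hz2 := neg_abs_le z.re
  set a : ℂ := (1 + c - z) / 2 with ha_def
  set b : ℂ := (1 + c + z) / 2 with hb_def
  have ea : a = ((1/2:ℝ):ℂ) * (1 + c - z) := by rw [ha_def]; push_cast; ring
  have eb : b = ((1/2:ℝ):ℂ) * (1 + c + z) := by rw [hb_def]; push_cast; ring
  have ha : 0 < a.re := by rw [ea, Complex.re_ofReal_mul]; simp; linarith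
  have hb : 0 < b.re := by rw [eb, Complex.re_ofReal_mul]; simp; linarith
  have hre : ∀ (a : ℂ) (τ : ℝ), (a + τ * I / 2).re = a.re := fun a τ => by simp
  have hF : ∀ τ : ℝ, mellin (ff v z) (c + τ * I) = (2:ℂ) ^ ((c:ℂ) + τ * I - 1) *
      mellin (phi v) (a + τ * I / 2) * mellin (phi v) (b + τ * I / 2) := by
    intro τ
    rw [(ff_mellin v z (c + τ * I) (by simp; linarith) (by simp; linarith)).2]
    congr 2
    · congr 1; rw [ha_def]; ring
    · rw [hb_def]; ring
  obtain ⟨C1, hC1, hC1'⟩ := GF_bound v a.re ha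
  obtain ⟨C2, hC2, hC2'⟩ := GF_bound v b.re hb
  unfold Complex.VerticalIntegrable
  simp_rw [hF]
  have hM : ∀ a : ℂ, 0 < a.re → Continuous fun τ : ℝ => mellin (phi v) (a + τ * I / 2) := by
    intro a ha
    rw [continuous_iff_continuousAt]
    intro τ
    have := (phi_diff v (a + τ * I / 2) (by rw [hre]; exact ha)).continuousAt
    exact ContinuousAt.comp (f := fun τ : ℝ => a + τ * I / 2) this (by fun_prop)
  have h2c : Continuous fun τ : ℝ => (2:ℂ) ^ ((c:ℂ) + τ * I - 1) :=
    Continuous.const_cpow (by fun_prop) (Or.inl two_ne_zero)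
  refine Integrable.mono' (((integrable_inv_sq a ha).add (integrable_inv_sq b hb)).const_mul
    ((2:ℝ) ^ (c - 1) * (C1 * C2))) ((h2c.mul (hM a ha)).mul (hM b hb)).aestronglyMeasurable
    (Eventually.of_forall fun τ => ?_)
  have n2 : ‖(2:ℂ) ^ ((c:ℂ) + τ * I - 1)‖ = (2:ℝ) ^ (c - 1) := by
    have := Complex.norm_cpow_eq_rpow_re_of_pos (x := 2) (by norm_num) ((c:ℂ) + τ * I - 1)
    simpa using this
  have na := hC1' (a + τ * I / 2) (hre a τ)
  have nb := hC2' (b + τ * I / 2) (hre b τ)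
  rw [← phi_mellin v _ (by rw [hre]; exact ha)] at na
  rw [← phi_mellin v _ (by rw [hre]; exact hb)] at nb
  simp only [Pi.add_apply]
  rw [norm_mul, norm_mul, n2, mul_assoc, mul_assoc]
  refine mul_le_mul_of_nonneg_left ?_ (by positivity)
  refine (mul_le_mul na nb (norm_nonneg _) (by positivity)).trans ?_
  rw [div_mul_div_comm, div_eq_mul_inv]
  refine mul_le_mul_of_nonneg_left ?_ (by positivity)
  rw [mul_inv, ← inv_pow, ← inv_pow]
  nlinarith [sq_nonneg (‖a + τ * I / 2‖⁻¹ - ‖b + τ * I / 2‖⁻¹), sq_nonneg (‖a + τ * I / 2‖⁻¹),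
    sq_nonneg (‖b + τ * I / 2‖⁻¹)]

lemma oneK_eq (z w : ℂ) (hz1 : -1 < z.re) (c : ℝ) (hc : -1 + |z.re| < c) (x : ℝ) (hx : 0 < x) :
    oneK z w c x = ff (-w ^ 2 / 4) z x := by
  have hz3 := le_abs_self z.re
  have hz4 := neg_abs_le z.re
  rw [← mellinInv_mellin_eq c (ff (-w ^ 2 / 4) z) hx
    (ff_mellin _ z c (by simp; linarith) (by simp; linarith)).1 (ff_vert _ z c hc)
    (ff_cont _ z hz1 x hx), mellinInv, oneK, Complex.real_smul]
  congr 1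
  · push_cast; ring
  refine integral_congr_ae (Eventually.of_forall fun τ => ?_)
  have e : (c:ℂ) + τ * I = c + I * τ := by ring
  have h1 : 0 < (1 + ((c:ℂ) + I * τ) - z).re := by simp; linarith
  have h2 : 0 < (1 + ((c:ℂ) + I * τ) + z).re := by simp; linarith
  have h3 : ∀ a : ℂ, 0 < a.re → 0 < (a / 2).re := fun a ha => by
    have : a / 2 = ((1/2:ℝ):ℂ) * a := by push_cast; ring
    rw [this, Complex.re_ofReal_mul]; linarith
  simp only [smul_eq_mul]
  rw [e, (ff_mellin _ z _ h1 h2).2, phi_mellin _ _ (h3 _ h1), phi_mellin _ _ (h3 _ h2)]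
  ring

lemma mellin_oneK_aux (w z : ℂ) (hz1 : -1 < z.re)
    (c : ℝ) (hc : -1 + |z.re| < c) (μ : ℂ) (hμ : -1 + |z.re| < μ.re) :
      ∫ x in Ioi (0:ℝ), (x:ℂ) ^ (μ - 1) * oneK z w c x
        = (2:ℂ) ^ (μ - 1) * Complex.Gamma ((1 + μ - z) / 2) * Complex.Gamma ((1 + μ + z) / 2) *
            oneF1 ((1 + μ - z) / 2) (3/2) (-w ^ 2 / 4) *
            oneF1 ((1 + μ + z) / 2) (3/2) (-w ^ 2 / 4) := by
  have hz3 := le_abs_self z.re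
  have hz4 := neg_abs_le z.re
  have h1 : 0 < (1 + μ - z).re := by simp; linarith
  have h2 : 0 < (1 + μ + z).re := by simp; linarith
  have h3 : ∀ a : ℂ, 0 < a.re → 0 < (a / 2).re := fun a ha => by
    have : a / 2 = ((1/2:ℝ):ℂ) * a := by push_cast; ring
    rw [this, Complex.re_ofReal_mul]; linarith
  have key := (ff_mellin (-w ^ 2 / 4) z μ h1 h2).2
  rw [phi_mellin _ _ (h3 _ h1), phi_mellin _ _ (h3 _ h2), mellin] at key
  calc _ = ∫ x in Ioi (0:ℝ), (x:ℂ) ^ (μ - 1) • ff (-w ^ 2 / 4) z x :=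
        setIntegral_congr_fun measurableSet_Ioi fun x hx => by
          simp only [smul_eq_mul]
          rw [oneK_eq z w hz1 c hc x hx]
    _ = _ := by rw [key]; ring

/-- Mellin-transform evaluation of `₁K_{z,w}` (equation (3.6) of Dixit–Kumar), together with
the particular case used in the proof of Theorem 1.6. -/
theorem mellin_oneK (w z : ℂ) (hz1 : -1 < z.re) (hz2 : z.re < 1)
    (c : ℝ) (hc : -1 + |z.re| < c) :
    (∀ μ : ℂ, -1 + |z.re| < μ.re →
      ∫ x in Ioi (0:ℝ), (x:ℂ) ^ (μ - 1) * oneK z w c x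
        = (2:ℂ) ^ (μ - 1) * Complex.Gamma ((1 + μ - z) / 2) * Complex.Gamma ((1 + μ + z) / 2) *
            oneF1 ((1 + μ - z) / 2) (3/2) (-w ^ 2 / 4) * oneF1 ((1 + μ + z) / 2) (3/2) (-w ^ 2 / 4))
    ∧ (∀ k : ℕ, 1 ≤ k →
      ∫ x in Ioi (0:ℝ), (x:ℂ) ^ (z / 2 + 2 * k - 1) * oneK (z / 2) (I * w) c x
        = (2:ℂ) ^ (z / 2 + 2 * k - 1) * Complex.Gamma ((k:ℂ) + 1/2) *
            Complex.Gamma ((z + 1) / 2 + k) *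
            oneF1 ((z + 1) / 2 + k) (3/2) (w ^ 2 / 4) * oneF1 (1/2 + (k:ℂ)) (3/2) (w ^ 2 / 4)) := by
  refine ⟨fun μ hμ => mellin_oneK_aux w z hz1 c hc μ hμ, fun k hk => ?_⟩
  have er : (z / 2).re = z.re / 2 := by
    have : z / 2 = ((1/2:ℝ):ℂ) * z := by push_cast; ring
    rw [this, Complex.re_ofReal_mul]; ring
  have ha : |(z / 2).re| ≤ |z.re| := by
    rw [er, abs_div, abs_two]
    linarith [abs_nonneg z.re]
  have ha1 : |(z / 2).re| < 1 / 2 := by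
    rw [er, abs_lt]; constructor <;> linarith
  have hk' : (1:ℝ) ≤ k := by exact_mod_cast hk
  have hμ : (z / 2 + 2 * (k:ℂ)).re = (z / 2).re + 2 * k := by simp
  have := mellin_oneK_aux (I * w) (z / 2) (by rw [er]; linarith) c (by linarith) (z / 2 + 2 * k)
    (by rw [hμ]; linarith [neg_abs_le (z / 2).re])
  rw [this]
  have e1 : (1 + (z / 2 + 2 * (k:ℂ)) - z / 2) / 2 = (k:ℂ) + 1 / 2 := by ring
  have e2 : (1 + (z / 2 + 2 * (k:ℂ)) + z / 2) / 2 = (z + 1) / 2 + k := by ring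
  have e3 : -(I * w) ^ 2 / 4 = w ^ 2 / 4 := by rw [mul_pow, I_sq]; ring
  rw [e1, e2, e3, add_comm (1 / 2 : ℂ) (k:ℂ)]
  ring
end
end
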